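/- A proper morphism of schemes with finite fibers is a finite morphism. -/

import Mathlib

open AlgebraicGeometry

/-- A proper morphism of schemes with finite fibers is a finite morphism. -/
theorem proper_quasiFinite_isFinite {X Y : AlgebraicGeometry.Scheme}
    (f : X ⟶ Y) [IsProper f]
    (hfib : ∀ y : Y, (f.base ⁻¹' {y}).Finite) :
    IsFinite f := by
  have : LocallyQuasiFinite f := LocallyQuasiFinite.of_finite_preimage_singleton f hfib
  exact IsFinite.of_isProper_of_locallyQuasiFinite f
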